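/- For any 8 points l_1,...,l_8 in generic position in P³(F), the composition p ∘ (ν_{1,2} ⊗ id) ∘ δ_{3,1} vanishes: applying ν_{1,2} ⊗ id to δ_{3,1}(l_1,...,l_8) ∈ A_3^0(F) ⊗ F* and then the map p : x_1 ⊗ y_2 ⊗ z_1 ↦ −a_2(y_2) ⊗ (x_1 ∧ z_1) gives zero in B_2(F) ⊗ Λ²F*; equivalently, Alt_8( a_2(l_5 | l_2,l_3,l_4; l_6,l_7,l_8) ⊗ Δ(l_5,l_2,l_3,l_4) ∧ Δ(l_5,l_6,l_7,l_8) ) = 0. -/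

import Mathlib

noncomputable section
open scoped TensorProduct
open Classical

namespace Gon

variable (F : Type) [Field F]

/-- Points of the projective space `P^{d-1}(F)`, i.e. lines in `F^d`. -/
abbrev Pt (d : ℕ) := Projectivization F (Fin d → F)

variable {F}

/-- Determinant of a `d`-tuple of vectors in `F^d` (w.r.t. the standard volume form). -/
def dt {d : ℕ} (v : Fin d → (Fin d → F)) : F := Matrix.det (Matrix.of v)

/-- `Δ` of three vectors of `F^3`. -/
def det3 (a b c : Fin 3 → F) : F := dt ![a, b, c]

/-- `Δ` of four vectors of `F^4`. -/
def det4 (a b c d : Fin 4 → F) : F := dt ![a, b, c, d]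

/-- Cross-ratio of four points on the projective line. -/
def cr1 (a b c d : Pt F 2) : F :=
  (dt ![a.rep, c.rep] * dt ![b.rep, d.rep]) / (dt ![a.rep, d.rep] * dt ![b.rep, c.rep])

/-- Cross-ratio of the four points of `P^1` obtained by projecting `a b c d` from the
centre `e` in the projective plane. -/
def crFrom3 (e a b c d : Pt F 3) : F :=
  (det3 e.rep a.rep c.rep * det3 e.rep b.rep d.rep) /
    (det3 e.rep a.rep d.rep * det3 e.rep b.rep c.rep)

/-- Cross-ratio of the four points of `P^1` obtained by projecting `a b c d` from the
line through `p` and `q` in `P^3`. -/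
def crLine (p q a b c d : Pt F 4) : F :=
  (det4 p.rep q.rep a.rep c.rep * det4 p.rep q.rep b.rep d.rep) /
    (det4 p.rep q.rep a.rep d.rep * det4 p.rep q.rep b.rep c.rep)

variable (F)

/-- `ℚ[F]`, the free `ℚ`-vector space on the set `F`. -/
abbrev QF := F →₀ ℚ

variable {F}

/-- The generator `{x}` of `ℚ[F]`, with the convention `{0} = {∞} = 0`. -/
def gen (a : F) : QF F := if a = 0 then 0 else Finsupp.single a 1

/-- The five term element of `ℚ[F]` attached to five points of the projective line. -/
def fiveTerm (x : Fin 5 → Pt F 2) : QF F :=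
  ∑ i : Fin 5, ((-1 : ℤ) ^ (i : ℕ)) •
    gen (cr1 (x (i.succAbove 0)) (x (i.succAbove 1)) (x (i.succAbove 2)) (x (i.succAbove 3)))

variable (F)

/-- `R_2(F)`: the five-term relations for five distinct points of `P^1(F)`, together with
`{1}` (the generators of `ℤ[F^* ∖ {1}]` omit `1`). -/
def R2 : Submodule ℚ (QF F) :=
  Submodule.span ℚ
    ({z | ∃ x : Fin 5 → Pt F 2, Function.Injective x ∧ z = fiveTerm x} ∪ {gen (1 : F)})

/-- The Bloch group `B_2(F)` (tensored with `ℚ`). -/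
abbrev B2 := QF F ⧸ R2 F

def clsB2 : QF F →ₗ[ℚ] B2 F := (R2 F).mkQ

/-- `{x}_2 ∈ B_2(F)`. -/
def b2 (a : F) : B2 F := clsB2 F (gen a)

variable {F}

variable (F)

/-- `F^* ⊗ ℚ`, presented as the free `ℚ`-vector space on `F` modulo multiplicativity
(and modulo the generator at `0`). -/
def FSrel : Set (QF F) :=
  {z | ∃ x y : F, x ≠ 0 ∧ y ≠ 0 ∧
      z = Finsupp.single (x * y) 1 - Finsupp.single x 1 - Finsupp.single y 1} ∪
    {Finsupp.single (0 : F) 1}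

abbrev FS := QF F ⧸ Submodule.span ℚ (FSrel F)

/-- The class of `x ∈ F` in `F^* ⊗ ℚ`. -/
def fs (a : F) : FS F := (Submodule.span ℚ (FSrel F)).mkQ (Finsupp.single a 1)

variable {F}

variable (F)

/-- The exterior algebra of `F^* ⊗ ℚ`, housing `Λ² F^*`. -/
abbrev LamFS := ExteriorAlgebra ℚ (FS F)

/-- `B_2(F) ⊗ Λ² F^*` (inside `B_2(F) ⊗ Λ^•(F^* ⊗ ℚ)`). -/
abbrev T22 := B2 F ⊗[ℚ] LamFS F

variable {F}

/-- wedge product. -/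
def wedge {M : Type} [AddCommGroup M] [Module ℚ M] (a b : M) : ExteriorAlgebra ℚ M :=
  ExteriorAlgebra.ι ℚ a * ExteriorAlgebra.ι ℚ b

/-- Eight points of `P^3` are in generic position when any four of them are projectively
independent. -/
def Generic8 (x : Fin 8 → Pt F 4) : Prop :=
  ∀ a b c d : Fin 8, a ≠ b → a ≠ c → a ≠ d → b ≠ c → b ≠ d → c ≠ d →
    det4 (x a).rep (x b).rep (x c).rep (x d).rep ≠ 0

/-- `a_2` of the configuration of `3+3` points of `P^2` obtained by projecting the points
`x; y` of `P^3` from the centre `e`: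
`Σ_{i,j} (-1)^{i+j} {r(x_i | x̂_i; ŷ_j)}` (cross-ratios after projection from `e, x_i`). -/
def a2From4 (e : Pt F 4) (x y : Fin 3 → Pt F 4) : QF F :=
  ∑ i : Fin 3, ∑ j : Fin 3, ((-1 : ℤ) ^ ((i : ℕ) + (j : ℕ))) •
    gen (crLine e (x i) (x (i.succAbove 0)) (x (i.succAbove 1))
      (y (j.succAbove 0)) (y (j.succAbove 1)))

theorem det4_plucker (p q a b c d : Fin 4 → F) :
    det4 p q a b * det4 p q c d - det4 p q a c * det4 p q b d
      + det4 p q a d * det4 p q b c = 0 := by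
  simp [det4, dt, Matrix.det_succ_row_zero, Fin.sum_univ_succ, Fin.succAbove]
  ring

theorem det4_swap_second_third (p q a b : Fin 4 → F) : det4 p q a b = -det4 p a q b := by
  simp [det4, dt, Matrix.det_succ_row_zero, Fin.sum_univ_succ, Fin.succAbove]
  ring

theorem det4_swap_third_fourth (p q a b : Fin 4 → F) : det4 p q a b = -det4 p q b a := by
  simp [det4, dt, Matrix.det_succ_row_zero, Fin.sum_univ_succ, Fin.succAbove]
  ring

theorem det4_rotate (p q a b : Fin 4 → F) : det4 p q a b = det4 p a b q := by
  rw [det4_swap_second_third, det4_swap_third_fourth, neg_neg]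

theorem cr1_mk (u v w z : Fin 2 → F) (hu : u ≠ 0) (hv : v ≠ 0) (hw : w ≠ 0) (hz : z ≠ 0) :
    cr1 (.mk F u hu) (.mk F v hv) (.mk F w hw) (.mk F z hz) =
      (dt ![u, w] * dt ![v, z]) / (dt ![u, z] * dt ![v, w]) := by
  obtain ⟨a, ha⟩ := Projectivization.exists_smul_eq_mk_rep F u hu
  obtain ⟨b, hb⟩ := Projectivization.exists_smul_eq_mk_rep F v hv
  obtain ⟨c, hc⟩ := Projectivization.exists_smul_eq_mk_rep F w hw
  obtain ⟨d, hd⟩ := Projectivization.exists_smul_eq_mk_rep F z hz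
  have h : (a * b * c * d : F) ≠ 0 := by simp
  rw [cr1, ← ha, ← hb, ← hc, ← hd, ← mul_div_mul_left (dt ![u, w] * dt ![v, z]) _ h]
  simp only [dt, Matrix.det_fin_two, Matrix.of_apply, Matrix.cons_val_zero, Matrix.cons_val_one,
    Pi.smul_apply, Units.smul_def, smul_eq_mul]
  congr 1 <;> ring

theorem mk_ne_mk_of_dt_ne_zero {u v : Fin 2 → F} (hu : u ≠ 0) (hv : v ≠ 0)
    (h : dt ![u, v] ≠ 0) : Projectivization.mk F u hu ≠ .mk F v hv := by
  intro e
  obtain ⟨a, rfl⟩ := (Projectivization.mk_eq_mk_iff' F u v hu hv).1 e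
  apply h
  simp [dt, Matrix.det_fin_two]
  ring

/-- The five-term relation for five vectors of the plane with non-vanishing brackets. -/
theorem b2_fiveTerm_of_vectors (v : Fin 5 → Fin 2 → F)
    (h : ∀ i j, i < j → dt ![v i, v j] ≠ 0) :
    b2 F ((dt ![v 1, v 3] * dt ![v 2, v 4]) / (dt ![v 1, v 4] * dt ![v 2, v 3]))
      - b2 F ((dt ![v 0, v 3] * dt ![v 2, v 4]) / (dt ![v 0, v 4] * dt ![v 2, v 3]))
      + b2 F ((dt ![v 0, v 3] * dt ![v 1, v 4]) / (dt ![v 0, v 4] * dt ![v 1, v 3]))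
      - b2 F ((dt ![v 0, v 2] * dt ![v 1, v 4]) / (dt ![v 0, v 4] * dt ![v 1, v 2]))
      + b2 F ((dt ![v 0, v 2] * dt ![v 1, v 3]) / (dt ![v 0, v 3] * dt ![v 1, v 2])) = 0 := by
  have h' : ∀ i j, i ≠ j → dt ![v i, v j] ≠ 0 := by
    intro i j hij
    rcases lt_or_gt_of_ne hij with hlt | hlt
    · exact h i j hlt
    · intro e
      apply h j i hlt
      simp only [dt, Matrix.det_fin_two, Matrix.of_apply, Matrix.cons_val_zero,
        Matrix.cons_val_one] at e ⊢
      linear_combination -e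
  have hv : ∀ i, v i ≠ 0 := by
    intro i e
    obtain ⟨j, hj⟩ := exists_ne i
    apply h' i j hj.symm
    simp [dt, Matrix.det_fin_two, e]
  have hinj : Function.Injective fun i => Projectivization.mk F (v i) (hv i) := by
    intro i j e
    by_contra hij
    exact mk_ne_mk_of_dt_ne_zero (hv i) (hv j) (h' i j hij) e
  have hmem := Submodule.subset_span (R := ℚ) (s := {z : QF F | ∃ x : Fin 5 → Pt F 2,
    Function.Injective x ∧ z = fiveTerm x} ∪ {gen (1 : F)}) (Or.inl ⟨_, hinj, rfl⟩)
  have := (Submodule.Quotient.mk_eq_zero (R2 F)).2 hmem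
  rw [← Submodule.mkQ_apply, fiveTerm, map_sum] at this
  simpa [cr1_mk, b2, clsB2, Fin.sum_univ_five, Fin.succAbove, sub_eq_add_neg] using this

/-- The five-term relation in terms of ten non-zero brackets subject to the Plücker relations. -/
theorem b2_fiveTerm_of_brackets {b01 b02 b03 b04 b12 b13 b14 b23 b24 b34 : F}
    (h01 : b01 ≠ 0) (h02 : b02 ≠ 0) (h03 : b03 ≠ 0) (h04 : b04 ≠ 0) (h12 : b12 ≠ 0)
    (h13 : b13 ≠ 0) (h14 : b14 ≠ 0) (h23 : b23 ≠ 0) (h24 : b24 ≠ 0) (h34 : b34 ≠ 0)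
    (p23 : b01 * b23 - b02 * b13 + b03 * b12 = 0)
    (p24 : b01 * b24 - b02 * b14 + b04 * b12 = 0)
    (p34 : b01 * b34 - b03 * b14 + b04 * b13 = 0) :
    b2 F ((b13 * b24) / (b14 * b23)) - b2 F ((b03 * b24) / (b04 * b23))
      + b2 F ((b03 * b14) / (b04 * b13)) - b2 F ((b02 * b14) / (b04 * b12))
      + b2 F ((b02 * b13) / (b03 * b12)) = 0 := by
  have e23 : b02 * b13 - b12 * b03 = b01 * b23 := by linear_combination -p23
  have e24 : b02 * b14 - b12 * b04 = b01 * b24 := by linear_combination -p24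
  have e34 : b03 * b14 - b13 * b04 = b01 * b34 := by linear_combination -p34
  have hcr : ∀ x y z w : F, (b01 * x) * (b01 * y) / ((b01 * z) * (b01 * w)) =
      x * y / (z * w) := by
    intro x y z w
    rw [← mul_div_mul_left (x * y) (z * w) (mul_ne_zero h01 h01)]
    congr 1 <;> ring
  have d2 : ∀ x y z w : F, dt ![![x, y], ![z, w]] = x * w - y * z := by
    intro x y z w
    simp [dt, Matrix.det_fin_two]
  have key := b2_fiveTerm_of_vectors
    ![![0, -b01], ![b01, 0], ![b02, b12], ![b03, b13], ![b04, b14]] (by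
      intro i j hij
      fin_cases i <;> fin_cases j <;>
        first
        | exact absurd hij (by decide)
        | simp_all)
  simpa [d2, e23, e24, e34, hcr] using key

/-- The five-term relation for the projections of five points from a line of `P³`. -/
theorem b2_crLine_fiveTerm (p q : Pt F 4) (x : Fin 5 → Pt F 4)
    (h : ∀ i j, i < j → det4 p.rep q.rep (x i).rep (x j).rep ≠ 0) :
    b2 F (crLine p q (x 1) (x 2) (x 3) (x 4)) - b2 F (crLine p q (x 0) (x 2) (x 3) (x 4))
      + b2 F (crLine p q (x 0) (x 1) (x 3) (x 4)) - b2 F (crLine p q (x 0) (x 1) (x 2) (x 4))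
      + b2 F (crLine p q (x 0) (x 1) (x 2) (x 3)) = 0 :=
  b2_fiveTerm_of_brackets (h 0 1 (by decide)) (h 0 2 (by decide)) (h 0 3 (by decide))
    (h 0 4 (by decide)) (h 1 2 (by decide)) (h 1 3 (by decide)) (h 1 4 (by decide))
    (h 2 3 (by decide)) (h 2 4 (by decide)) (h 3 4 (by decide))
    (det4_plucker _ _ _ _ _ _) (det4_plucker _ _ _ _ _ _) (det4_plucker _ _ _ _ _ _)

/-- The five-term relation for the five projections, from a line joining `e` to one of five
points, of the remaining four points. -/
theorem b2_crLine_fiveTerm_conic (e : Pt F 4) (x : Fin 5 → Pt F 4)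
    (h : ∀ i j k, i < j → j < k → det4 e.rep (x i).rep (x j).rep (x k).rep ≠ 0) :
    b2 F (crLine e (x 0) (x 1) (x 2) (x 3) (x 4)) - b2 F (crLine e (x 1) (x 0) (x 2) (x 3) (x 4))
      + b2 F (crLine e (x 2) (x 0) (x 1) (x 3) (x 4))
      - b2 F (crLine e (x 3) (x 0) (x 1) (x 2) (x 4))
      + b2 F (crLine e (x 4) (x 0) (x 1) (x 2) (x 3)) = 0 := by
  have s2 := fun i j k => det4_swap_second_third e.rep (x i).rep (x j).rep (x k).rep
  have s3 := fun i j k => det4_swap_third_fourth e.rep (x i).rep (x j).rep (x k).rep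
  have r := fun i j k => det4_rotate e.rep (x i).rep (x j).rep (x k).rep
  have pl := fun i j k l m =>
    det4_plucker e.rep (x i).rep (x j).rep (x k).rep (x l).rep (x m).rep
  have p4 := pl 4 0 1 2 3
  have p3 := pl 3 0 1 2 4
  have p2 := pl 2 0 1 3 4
  simp only [r 4] at p4
  simp only [r 3 0 1, r 3 0 2, r 3 1 2, s2 3 2, s2 3 1, s2 3 0] at p3
  simp only [r 2 0 1, s2 2 1, s2 2 0] at p2
  have key := b2_fiveTerm_of_brackets (h 2 3 4 (by decide) (by decide))
    (h 1 3 4 (by decide) (by decide)) (h 1 2 4 (by decide) (by decide))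
    (h 1 2 3 (by decide) (by decide)) (h 0 3 4 (by decide) (by decide))
    (h 0 2 4 (by decide) (by decide)) (h 0 2 3 (by decide) (by decide))
    (h 0 1 4 (by decide) (by decide)) (h 0 1 3 (by decide) (by decide))
    (h 0 1 2 (by decide) (by decide))
    (by linear_combination p4) (by linear_combination -p3) (by linear_combination p2)
  simp only [crLine, s2 1 0, s2 2 0, s2 2 1, s2 3 0, s2 3 1, s2 4 0, s2 4 1, s3 _ 3 2, s3 _ 4 2,
    s3 _ 4 3, neg_mul, mul_neg, neg_neg, neg_div_neg_eq]
  simp only [mul_comm] at key ⊢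
  exact key

theorem crLine_swap_pairs (p q a b c d : Pt F 4) : crLine p q a b c d = crLine p q c d a b := by
  have s3 := fun u v : Pt F 4 => det4_swap_third_fourth p.rep q.rep u.rep v.rep
  simp only [crLine]
  rw [s3 c a, s3 d b, s3 c b, s3 d a]
  simp only [neg_mul_neg]
  rw [mul_comm (det4 p.rep q.rep b.rep c.rep)]

/-- Antisymmetry of `a_2` in `B_2(F)`. -/
theorem clsB2_a2From4_antisymm (e : Pt F 4) (z : Fin 6 → Pt F 4)
    (h : ∀ i j k, i ≠ j → i ≠ k → j ≠ k → det4 e.rep (z i).rep (z j).rep (z k).rep ≠ 0) :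
    clsB2 F (a2From4 e ![z 0, z 1, z 2] ![z 3, z 4, z 5]) =
      -clsB2 F (a2From4 e ![z 3, z 4, z 5] ![z 0, z 1, z 2]) := by
  have line := fun (i : Fin 6) (w : Fin 5 → Fin 6)
      (hw : ∀ a b, a < b → i ≠ w a ∧ i ≠ w b ∧ w a ≠ w b) =>
    b2_crLine_fiveTerm e (z i) (z ∘ w) fun a b hab =>
      h _ _ _ (hw a b hab).1 (hw a b hab).2.1 (hw a b hab).2.2
  have conic := fun (w : Fin 5 → Fin 6) (hw : StrictMono w) =>
    b2_crLine_fiveTerm_conic e (z ∘ w) fun a b c hab hbc =>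
      h _ _ _ (hw hab).ne (hw (hab.trans hbc)).ne (hw hbc).ne
  have l0 := line 0 ![1, 2, 3, 4, 5] (by decide)
  have l1 := line 1 ![0, 2, 3, 4, 5] (by decide)
  have l2 := line 2 ![0, 1, 3, 4, 5] (by decide)
  have c01 := conic ![0, 1, 3, 4, 5] (by decide)
  have c02 := conic ![0, 2, 3, 4, 5] (by decide)
  have c12 := conic ![1, 2, 3, 4, 5] (by decide)
  simp only [a2From4, Fin.sum_univ_three, map_add, map_zsmul, ← b2.eq_1]
  simp [Fin.succAbove] at l0 l1 l2 c01 c02 c12 ⊢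
  simp only [crLine_swap_pairs e (z 3) (z 4) (z 5), crLine_swap_pairs e (z 4) (z 3) (z 5),
    crLine_swap_pairs e (z 5) (z 3) (z 4)]
  linear_combination (norm := module) l0 - l1 + l2 + c01 - c02 + c12

theorem wedge_swap {M : Type} [AddCommGroup M] [Module ℚ M] (a b : M) :
    wedge a b = -wedge b a :=
  eq_neg_of_add_eq_zero_left (ExteriorAlgebra.ι_add_mul_swap a b)

/-- Lemma 5.6.  For any eight points in generic position in `P³(F)`,
the composition `p ∘ (ν_{1,2} ⊗ id) ∘ δ_{3,1}` vanishes; equivalently (indices `1`-based):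
`Alt_8( a_2(l_5 | l_2,l_3,l_4; l_6,l_7,l_8) ⊗ Δ(l_5,l_2,l_3,l_4) ∧ Δ(l_5,l_6,l_7,l_8) ) = 0`
in `B_2(F) ⊗ Λ²F^*`. -/
theorem statement15 (F : Type) [Field F] (x : Fin 8 → Pt F 4) (hx : Generic8 x) :
    ∑ σ : Equiv.Perm (Fin 8), (Equiv.Perm.sign σ : ℤ) •
      (clsB2 F (a2From4 (x (σ 4)) ![x (σ 1), x (σ 2), x (σ 3)] ![x (σ 5), x (σ 6), x (σ 7)])
        ⊗ₜ[ℚ]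
        wedge (fs F (det4 (x (σ 4)).rep (x (σ 1)).rep (x (σ 2)).rep (x (σ 3)).rep))
          (fs F (det4 (x (σ 4)).rep (x (σ 5)).rep (x (σ 6)).rep (x (σ 7)).rep))) = 0 := by
  let τ : Equiv.Perm (Fin 8) := Equiv.swap 1 5 * Equiv.swap 2 6 * Equiv.swap 3 7
  have hτ : Equiv.Perm.sign τ = -1 := by decide
  refine Finset.sum_involution (fun σ _ => σ * τ) ?_ ?_ (fun _ _ => Finset.mem_univ _) ?_
  · intro σ _
    have ht : τ 1 = 5 ∧ τ 2 = 6 ∧ τ 3 = 7 ∧ τ 4 = 4 ∧ τ 5 = 1 ∧ τ 6 = 2 ∧ τ 7 = 3 := by decide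
    obtain ⟨h1, h2, h3, h4, h5, h6, h7⟩ := ht
    have hσ : Function.Injective σ := σ.injective
    have ha : clsB2 F (a2From4 (x (σ 4)) ![x (σ 1), x (σ 2), x (σ 3)]
          ![x (σ 5), x (σ 6), x (σ 7)]) =
        -clsB2 F (a2From4 (x (σ 4)) ![x (σ 5), x (σ 6), x (σ 7)]
          ![x (σ 1), x (σ 2), x (σ 3)]) :=
      clsB2_a2From4_antisymm (x (σ 4)) (fun i => x (σ (![1, 2, 3, 5, 6, 7] i))) (by
        intro i j k hij hik hjk
        apply hx <;> apply hσ.ne <;> revert i j k <;> decide)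
    simp only [Equiv.Perm.sign_mul, hτ, Equiv.Perm.mul_apply, h1, h2, h3, h4, h5, h6, h7]
    rw [ha, wedge_swap]
    simp [TensorProduct.neg_tmul, TensorProduct.tmul_neg]
  · intro σ _ _ e
    have : τ = 1 := by simpa using e
    rw [this] at hτ
    revert hτ
    simp
  · intro σ _
    have : τ * τ = 1 := by decide
    rw [mul_assoc, this, mul_one]

end Gon
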